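/- There is a constant C > 0 such that for every ω ≥ 1 and every Schwartz function f on ℝ³ = ℝ² × ℝ (variables (x,z)), the function P₀f defined by (P₀f)(x,z) = (∫_ℝ f(x,z') h_ω(z') dz') · h_ω(z) satisfies ‖P₀f‖_{L⁶(ℝ³)} ≤ C ω^{1/6} ( ‖f‖²_{L²(ℝ³)} + ‖∇_x f‖²_{L²(ℝ³)} )^{1/2}. -/

import Mathlib

open MeasureTheory Complex

noncomputable section

/-- ℝ² with the Euclidean norm. -/
abbrev R2 : Type := EuclideanSpace ℝ (Fin 2)

/-- ℝ³ written as ℝ² × ℝ, points r = (x, z). -/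
abbrev R3 : Type := R2 × ℝ

/-- Directional derivative of `f` at `p` in the direction `v`. -/
def pd {E F : Type*} [NormedAddCommGroup E] [NormedSpace ℝ E]
    [NormedAddCommGroup F] [NormedSpace ℝ F] (v : E) (f : E → F) (p : E) : F :=
  fderiv ℝ f p v

/-- Second directional derivative in the direction `v`. -/
def pd2 {E F : Type*} [NormedAddCommGroup E] [NormedSpace ℝ E]
    [NormedAddCommGroup F] [NormedSpace ℝ F] (v : E) (f : E → F) (p : E) : F :=
  pd v (pd v f) p

/-- First coordinate direction in the x-plane. -/
def ex0 : R3 := (EuclideanSpace.single 0 1, 0)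

/-- Second coordinate direction in the x-plane. -/
def ex1 : R3 := (EuclideanSpace.single 1 1, 0)

/-- The z-direction. -/
def ez : R3 := (0, 1)

/-- The full Laplacian on ℝ³ = ℝ² × ℝ. -/
def lap3 {F : Type*} [NormedAddCommGroup F] [NormedSpace ℝ F]
    (f : R3 → F) (p : R3) : F :=
  pd2 ex0 f p + pd2 ex1 f p + pd2 ez f p

/-- The operator `S² f = (1−ω)f − Δf + ω² z² f` on functions on ℝ³. -/
def S2op (ω : ℝ) (f : R3 → ℂ) (p : R3) : ℂ :=
  ((1 - ω : ℝ) : ℂ) * f p - lap3 f p + ((ω ^ 2 * p.2 ^ 2 : ℝ) : ℂ) * f p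
/-- Normalized ground state `h_ω(z) = ω^{1/4} π^{-1/4} e^{-ωz²/2}` of `−∂_z² + ω²z²`. -/
def hosc (ω z : ℝ) : ℝ :=
  ω ^ ((1 : ℝ) / 4) * Real.pi ^ (-(1 : ℝ) / 4) * Real.exp (-(ω * z ^ 2) / 2)

/-- Orthogonal projection (in the z-variable) onto the span of `h_ω`:
`(P₀f)(x,z) = (∫ f(x,zᐟ) h_ω(zᐟ) dzᐟ) h_ω(z)`. -/
def P0 (ω : ℝ) (f : R3 → ℂ) (p : R3) : ℂ :=
  (∫ zp : ℝ, f (p.1, zp) * (hosc ω zp : ℂ)) * (hosc ω p.2 : ℂ)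

/-- A function on the line vanishing at `-∞` is bounded by the `L¹` norm of its derivative. -/
theorem enorm_le_lintegral_of_hasDerivAt_of_tendsto {u u' : ℝ → ℂ}
    (hu : ∀ t, HasDerivAt u (u' t) t) (h0 : Filter.Tendsto u Filter.atBot (nhds 0)) (a : ℝ) :
    ‖u a‖ₑ ≤ ∫⁻ t, ‖u' t‖ₑ := by
  have hu' : u' = deriv u := funext fun t => (hu t).deriv.symm
  by_cases hfin : ∫⁻ t, ‖u' t‖ₑ = ⊤
  · simp [hfin]
  have hint : Integrable u' :=
    ⟨hu' ▸ (measurable_deriv u).aestronglyMeasurable, lt_top_iff_ne_top.2 hfin⟩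
  have h := integral_Iic_of_hasDerivAt_of_tendsto (a := a)
    (hu a).continuousAt.continuousWithinAt (fun x _ => hu x) hint.integrableOn h0
  rw [sub_zero] at h
  rw [← h]
  exact (enorm_integral_le_lintegral_enorm _).trans (setLIntegral_le_lintegral _ _)

/-- The Cauchy–Schwarz inequality for lower Lebesgue integrals. -/
theorem lintegral_mul_sq_le {α : Type*} [MeasurableSpace α] {μ : Measure α} {f g : α → ENNReal}
    (hf : AEMeasurable f μ) (hg : AEMeasurable g μ) :
    (∫⁻ a, f a * g a ∂μ) ^ 2 ≤ (∫⁻ a, f a ^ 2 ∂μ) * ∫⁻ a, g a ^ 2 ∂μ := by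
  have h := ENNReal.lintegral_mul_le_Lp_mul_Lq μ Real.HolderConjugate.two_two hf hg
  have key : ∀ x : ENNReal, (x ^ ((1 : ℝ) / 2)) ^ 2 = x := fun x => by
    rw [← ENNReal.rpow_natCast, ← ENNReal.rpow_mul]; norm_num
  calc (∫⁻ a, f a * g a ∂μ) ^ 2 ≤ _ := pow_le_pow_left₀ zero_le h 2
    _ = _ := by
      rw [mul_pow, key, key]
      simp only [ENNReal.rpow_ofNat]

/-- Integration over the Euclidean plane in Cartesian coordinates. -/
theorem lintegral_R2_eq_lintegral_prod (F : R2 → ENNReal) :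
    ∫⁻ x, F x = ∫⁻ p : ℝ × ℝ,
      F (p.1 • EuclideanSpace.single 0 1 + p.2 • EuclideanSpace.single 1 1) := by
  have h := ((volume_preserving_finTwoArrow ℝ).symm).trans
    (EuclideanSpace.volume_preserving_symm_measurableEquiv_toLp (Fin 2)).symm
  rw [← h.lintegral_comp_emb (MeasurableEquiv.measurableEmbedding _)]
  refine lintegral_congr fun p => congrArg F ?_
  ext i
  fin_cases i <;> simp [MeasurableEquiv.finTwoArrow]

/-- The Gagliardo–Nirenberg–Sobolev inequality `L¹ → L²` in the plane, for functions
vanishing at infinity along lines. -/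
theorem lintegral_enorm_sq_le_of_hasDerivAt {v v₁ v₂ : R2 → ℂ}
    (hm₁ : Measurable v₁) (hm₂ : Measurable v₂)
    (hd₁ : ∀ x, ∀ t : ℝ, HasDerivAt (fun s : ℝ => v (x + s • EuclideanSpace.single 0 1))
      (v₁ (x + t • EuclideanSpace.single 0 1)) t)
    (hd₂ : ∀ x, ∀ t : ℝ, HasDerivAt (fun s : ℝ => v (x + s • EuclideanSpace.single 1 1))
      (v₂ (x + t • EuclideanSpace.single 1 1)) t)
    (h0₁ : ∀ x, Filter.Tendsto (fun s : ℝ => v (x + s • EuclideanSpace.single 0 1))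
      Filter.atBot (nhds 0))
    (h0₂ : ∀ x, Filter.Tendsto (fun s : ℝ => v (x + s • EuclideanSpace.single 1 1))
      Filter.atBot (nhds 0)) :
    ∫⁻ x, ‖v x‖ₑ ^ 2 ≤ (∫⁻ x, ‖v₁ x‖ₑ) * ∫⁻ x, ‖v₂ x‖ₑ := by
  simp only [lintegral_R2_eq_lintegral_prod]
  set e : ℝ × ℝ → R2 := fun p =>
    p.1 • EuclideanSpace.single 0 1 + p.2 • EuclideanSpace.single 1 1 with he
  have hem : Measurable e := by
    have : Continuous e := by fun_prop
    exact this.measurable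
  have hM₁ : Measurable fun p => ‖v₁ (e p)‖ₑ := (hm₁.comp hem).enorm
  have hM₂ : Measurable fun p => ‖v₂ (e p)‖ₑ := (hm₂.comp hem).enorm
  have b₁ : ∀ p, ‖v (e p)‖ₑ ≤ ∫⁻ s, ‖v₁ (e (s, p.2))‖ₑ := fun p => by
    have h := enorm_le_lintegral_of_hasDerivAt_of_tendsto
      (hd₁ (p.2 • EuclideanSpace.single 1 1)) (h0₁ _) p.1
    simpa only [he, add_comm] using h
  have b₂ : ∀ p, ‖v (e p)‖ₑ ≤ ∫⁻ t, ‖v₂ (e (p.1, t))‖ₑ := fun p =>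
    enorm_le_lintegral_of_hasDerivAt_of_tendsto
      (hd₂ (p.1 • EuclideanSpace.single 0 1)) (h0₂ _) p.2
  calc ∫⁻ p, ‖v (e p)‖ₑ ^ 2
      ≤ ∫⁻ p : ℝ × ℝ, (∫⁻ t, ‖v₂ (e (p.1, t))‖ₑ) * ∫⁻ s, ‖v₁ (e (s, p.2))‖ₑ :=
        lintegral_mono fun p => by
          simp only [sq]
          exact mul_le_mul' (b₂ p) (b₁ p)
    _ = (∫⁻ s, ∫⁻ t, ‖v₂ (e (s, t))‖ₑ) * ∫⁻ t, ∫⁻ s, ‖v₁ (e (s, t))‖ₑ :=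
        lintegral_prod_mul hM₂.lintegral_prod_right'.aemeasurable
          hM₁.lintegral_prod_left'.aemeasurable
    _ = _ := by
        rw [mul_comm, Measure.volume_eq_prod, lintegral_prod_symm _ hM₁.aemeasurable,
          lintegral_prod _ hM₂.aemeasurable]

/-- The Sobolev-type inequality `∫ |u|⁶ ≤ 36 (∫ |u|²) (∫ |∂₁u|²) (∫ |∂₂u|²)` in the plane. -/
theorem lintegral_enorm_pow_six_le_of_hasDerivAt {u u₁ u₂ : R2 → ℂ} (hm : Measurable u)
    (hm₁ : Measurable u₁) (hm₂ : Measurable u₂)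
    (hd₁ : ∀ x, ∀ t : ℝ, HasDerivAt (fun s : ℝ => u (x + s • EuclideanSpace.single 0 1))
      (u₁ (x + t • EuclideanSpace.single 0 1)) t)
    (hd₂ : ∀ x, ∀ t : ℝ, HasDerivAt (fun s : ℝ => u (x + s • EuclideanSpace.single 1 1))
      (u₂ (x + t • EuclideanSpace.single 1 1)) t)
    (h0₁ : ∀ x, Filter.Tendsto (fun s : ℝ => u (x + s • EuclideanSpace.single 0 1))
      Filter.atBot (nhds 0))
    (h0₂ : ∀ x, Filter.Tendsto (fun s : ℝ => u (x + s • EuclideanSpace.single 1 1))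
      Filter.atBot (nhds 0)) :
    ∫⁻ x, ‖u x‖ₑ ^ 6 ≤
      36 * ((∫⁻ x, ‖u x‖ₑ ^ 2) * (∫⁻ x, ‖u₁ x‖ₑ ^ 2) * ∫⁻ x, ‖u₂ x‖ₑ ^ 2) := by
  set A := ∫⁻ x, ‖u x‖ₑ ^ 2
  set B₁ := ∫⁻ x, ‖u₁ x‖ₑ ^ 2
  set B₂ := ∫⁻ x, ‖u₂ x‖ₑ ^ 2
  set Q := ∫⁻ x, ‖u x‖ₑ ^ 4
  set X := ∫⁻ x, ‖u x‖ₑ ^ 6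
  have step : ∀ n : ℕ,
      (∫⁻ x, ‖u x‖ₑ ^ (2 * (n + 1))) ^ 2 ≤
        ((n + 1 : ℕ) : ENNReal) ^ 4 * (∫⁻ x, ‖u x‖ₑ ^ (2 * n)) ^ 2 * (B₁ * B₂) := by
    intro n
    have h := lintegral_enorm_sq_le_of_hasDerivAt (v := fun x => u x ^ (n + 1))
      (v₁ := fun x => ((n + 1 : ℕ) : ℂ) * u x ^ n * u₁ x)
      (v₂ := fun x => ((n + 1 : ℕ) : ℂ) * u x ^ n * u₂ x)
      (by fun_prop) (by fun_prop)
      (fun x t => (hd₁ x t).pow (n + 1)) (fun x t => (hd₂ x t).pow (n + 1))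
      (fun x => by simpa using (h0₁ x).pow (n + 1)) (fun x => by simpa using (h0₂ x).pow (n + 1))
    have cs : ∀ w : R2 → ℂ, Measurable w →
        (∫⁻ x, ‖((n + 1 : ℕ) : ℂ) * u x ^ n * w x‖ₑ) ^ 2 ≤
          ((n + 1 : ℕ) : ENNReal) ^ 2 * ((∫⁻ x, ‖u x‖ₑ ^ (2 * n)) * ∫⁻ x, ‖w x‖ₑ ^ 2) := by
      intro w hw
      have hc : ‖((n + 1 : ℕ) : ℂ)‖ₑ = ((n + 1 : ℕ) : ENNReal) := by
        rw [enorm_eq_nnnorm, Complex.nnnorm_natCast]; simp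
      simp only [enorm_mul, enorm_pow, hc, mul_assoc]
      rw [lintegral_const_mul _ (by fun_prop), mul_pow]
      gcongr
      refine (lintegral_mul_sq_le (by fun_prop) (by fun_prop)).trans_eq ?_
      simp only [← pow_mul, mul_comm n 2]
    calc (∫⁻ x, ‖u x‖ₑ ^ (2 * (n + 1))) ^ 2
        = (∫⁻ x, ‖u x ^ (n + 1)‖ₑ ^ 2) ^ 2 := by
          simp only [enorm_pow, ← pow_mul, mul_comm]
      _ ≤ _ := pow_le_pow_left₀ zero_le h 2
      _ ≤ _ := (mul_pow _ _ 2).trans_le (mul_le_mul' (cs _ hm₁) (cs _ hm₂))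
      _ = _ := by ring
  have hQ : Q ^ 2 ≤ 16 * A ^ 2 * (B₁ * B₂) := by
    have := step 1
    norm_num at this
    exact this
  have hX : X ^ 2 ≤ 81 * Q ^ 2 * (B₁ * B₂) := by
    have := step 2
    norm_num at this
    exact this
  refine (ENNReal.pow_le_pow_left_iff two_ne_zero).1 ?_
  calc X ^ 2 ≤ 81 * Q ^ 2 * (B₁ * B₂) := hX
    _ ≤ 81 * (16 * A ^ 2 * (B₁ * B₂)) * (B₁ * B₂) := by gcongr
    _ = (36 * (A * B₁ * B₂)) ^ 2 := by ring

theorem continuous_hosc (ω : ℝ) : Continuous (hosc ω) := by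
  unfold hosc; fun_prop

theorem hosc_nonneg {ω : ℝ} (hω : 0 ≤ ω) (z : ℝ) : 0 ≤ hosc ω z := by
  unfold hosc; positivity

theorem integrable_hosc {ω : ℝ} (hω : 0 < ω) : Integrable (hosc ω) := by
  have h := (integrable_exp_neg_mul_sq (half_pos hω)).const_mul
    (ω ^ ((1 : ℝ) / 4) * Real.pi ^ (-(1 : ℝ) / 4))
  refine h.congr (.of_forall fun z => ?_)
  simp only [hosc]
  ring_nf

theorem hosc_pow {ω : ℝ} (hω : 0 < ω) (n : ℕ) (z : ℝ) :
    hosc ω z ^ n = (ω / Real.pi) ^ ((n : ℝ) / 4) * Real.exp (-(n * ω / 2) * z ^ 2) := by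
  have h1 : ω ^ ((1 : ℝ) / 4) * Real.pi ^ (-(1 : ℝ) / 4) = (ω / Real.pi) ^ ((1 : ℝ) / 4) := by
    rw [Real.div_rpow hω.le Real.pi_pos.le, neg_div, Real.rpow_neg Real.pi_pos.le,
      ← div_eq_mul_inv]
  rw [hosc, h1, mul_pow, ← Real.rpow_natCast, ← Real.rpow_mul (by positivity), ← Real.exp_nat_mul]
  ring_nf

theorem lintegral_hosc_pow {ω : ℝ} (hω : 0 < ω) {n : ℕ} (hn : n ≠ 0) :
    ∫⁻ z, ‖(hosc ω z : ℂ)‖ₑ ^ n =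
      ENNReal.ofReal ((ω / Real.pi) ^ ((n : ℝ) / 4) * √(Real.pi / (n * ω / 2))) := by
  have hb : 0 < n * ω / 2 := by positivity
  rw [← integral_gaussian, ← integral_const_mul, ofReal_integral_eq_lintegral_ofReal
    ((integrable_exp_neg_mul_sq hb).const_mul _) (.of_forall fun z => by positivity)]
  refine lintegral_congr fun z => ?_
  rw [← hosc_pow hω, ENNReal.ofReal_pow (hosc_nonneg hω.le z), ← ofReal_norm, Complex.norm_real,
    Real.norm_of_nonneg (hosc_nonneg hω.le z)]

theorem lintegral_hosc_sq {ω : ℝ} (hω : 0 < ω) : ∫⁻ z, ‖(hosc ω z : ℂ)‖ₑ ^ 2 = 1 := by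
  rw [lintegral_hosc_pow hω two_ne_zero, ← ENNReal.ofReal_one]
  congr 1
  have h : ((2 : ℕ) : ℝ) / 4 = 1 / 2 := by norm_num
  have := Real.pi_pos
  rw [h, ← Real.sqrt_eq_rpow, ← Real.sqrt_mul (by positivity), Real.sqrt_eq_one]
  push_cast
  field_simp

theorem lintegral_hosc_pow_six_le {ω : ℝ} (hω : 0 < ω) :
    ∫⁻ z, ‖(hosc ω z : ℂ)‖ₑ ^ 6 ≤ ENNReal.ofReal ω := by
  rw [lintegral_hosc_pow hω (by norm_num)]
  refine ENNReal.ofReal_le_ofReal ?_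
  have hpi := Real.pi_gt_three
  have hp : 0 < ω / Real.pi := by positivity
  have h : ((6 : ℕ) : ℝ) / 4 = 1 + 1 / 2 := by norm_num
  rw [h, Real.rpow_add hp, Real.rpow_one, ← Real.sqrt_eq_rpow, mul_assoc,
    ← Real.sqrt_mul hp.le]
  have h3 : ω / Real.pi * (Real.pi / (((6 : ℕ) : ℝ) * ω / 2)) = 1 / 3 := by
    push_cast
    field_simp
    norm_num
  rw [h3]
  have h4 : √(1 / 3 : ℝ) ≤ 1 := Real.sqrt_le_one.2 (by norm_num)
  calc ω / Real.pi * √(1 / 3) ≤ ω / Real.pi * 1 := by gcongr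
    _ ≤ ω := by
      rw [mul_one]
      exact div_le_self hω.le (by linarith)

/-- The coefficient of `f` along `h_ω` in the `z`-variable. -/
def hoscCoeff (ω : ℝ) (f : SchwartzMap R3 ℂ) (x : R2) : ℂ :=
  ∫ z : ℝ, f (x, z) * (hosc ω z : ℂ)

theorem exists_norm_le (f : SchwartzMap R3 ℂ) : ∃ C, ∀ p, ‖f p‖ ≤ C :=
  ⟨SchwartzMap.seminorm ℝ 0 0 f, fun p => SchwartzMap.norm_le_seminorm ℝ f p⟩

theorem measurable_hoscCoeff (ω : ℝ) (f : SchwartzMap R3 ℂ) : Measurable (hoscCoeff ω f) := by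
  have hc := continuous_hosc ω
  have hf := f.continuous
  have : Continuous (Function.uncurry fun (x : R2) (z : ℝ) => f (x, z) * (hosc ω z : ℂ)) := by
    simp only [Function.uncurry_def]; fun_prop
  exact (StronglyMeasurable.integral_prod_right this.stronglyMeasurable).measurable

theorem lintegral_enorm_hoscCoeff_sq_le {ω : ℝ} (hω : 0 < ω) (f : SchwartzMap R3 ℂ) :
    ∫⁻ x, ‖hoscCoeff ω f x‖ₑ ^ 2 ≤ ∫⁻ p : R3, ‖f p‖ₑ ^ 2 := by
  have hc := continuous_hosc ω
  have hf := f.continuous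
  rw [Measure.volume_eq_prod, lintegral_prod _ (by fun_prop)]
  refine lintegral_mono fun x => ?_
  calc ‖hoscCoeff ω f x‖ₑ ^ 2
      ≤ (∫⁻ z, ‖f (x, z)‖ₑ * ‖(hosc ω z : ℂ)‖ₑ) ^ 2 := by
        gcongr
        refine (enorm_integral_le_lintegral_enorm _).trans_eq ?_
        simp only [enorm_mul]
    _ ≤ (∫⁻ z, ‖f (x, z)‖ₑ ^ 2) * ∫⁻ z, ‖(hosc ω z : ℂ)‖ₑ ^ 2 :=
        lintegral_mul_sq_le (by fun_prop) (by fun_prop)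
    _ = _ := by rw [lintegral_hosc_sq hω, mul_one]

theorem norm_mul_hosc_le {ω : ℝ} (hω : 0 < ω) {f : SchwartzMap R3 ℂ} {C : ℝ}
    (hC : ∀ p, ‖f p‖ ≤ C) (p : R3) (z : ℝ) : ‖f p * (hosc ω z : ℂ)‖ ≤ C * hosc ω z := by
  rw [norm_mul, Complex.norm_real, Real.norm_of_nonneg (hosc_nonneg hω.le z)]
  exact mul_le_mul_of_nonneg_right (hC p) (hosc_nonneg hω.le z)

theorem aestronglyMeasurable_mul_hosc (ω : ℝ) (f : SchwartzMap R3 ℂ) (x : R2) :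
    AEStronglyMeasurable (fun z : ℝ => f (x, z) * (hosc ω z : ℂ)) volume := by
  have hc := continuous_hosc ω
  have hf := f.continuous
  exact Continuous.aestronglyMeasurable (by fun_prop)

theorem tendsto_hoscCoeff_line {ω : ℝ} (hω : 0 < ω) (f : SchwartzMap R3 ℂ) {v : R2} (hv : v ≠ 0)
    (x : R2) :
    Filter.Tendsto (fun s : ℝ => hoscCoeff ω f (x + s • v)) Filter.atBot (nhds 0) := by
  obtain ⟨C, hC⟩ := exists_norm_le f
  have h := tendsto_integral_filter_of_dominated_convergence (μ := volume) (l := Filter.atBot)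
    (F := fun (s : ℝ) (z : ℝ) => f (x + s • v, z) * (hosc ω z : ℂ)) (f := fun _ => (0 : ℂ))
    (fun z => C * hosc ω z)
    (.of_forall fun s => aestronglyMeasurable_mul_hosc ω f _)
    (.of_forall fun s => .of_forall fun z => norm_mul_hosc_le hω hC _ z)
    ((integrable_hosc hω).const_mul C)
    (.of_forall fun z => by
      have hline : Filter.Tendsto (fun s : ℝ => ((x + s • v, z) : R3)) Filter.atBot
          (Filter.cocompact R3) := by
        rw [← Metric.cobounded_eq_cocompact, ← tendsto_norm_atTop_iff_cobounded]
        have h1 : Filter.Tendsto (fun s : ℝ => |s| * ‖v‖ - ‖x‖) Filter.atBot Filter.atTop :=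
          Filter.tendsto_atTop_add_const_right _ _
            (Filter.tendsto_abs_atBot_atTop.atTop_mul_const (norm_pos_iff.2 hv))
        refine Filter.tendsto_atTop_mono (fun s => ?_) h1
        calc |s| * ‖v‖ - ‖x‖ = ‖s • v‖ - ‖x‖ := by rw [norm_smul, Real.norm_eq_abs]
          _ ≤ ‖x + s • v‖ := by
            have := norm_sub_norm_le (s • v) (-x)
            rwa [norm_neg, sub_neg_eq_add, add_comm] at this
          _ ≤ _ := norm_fst_le ((x + s • v, z) : R3)
      simpa using ((zero_at_infty f).comp hline).mul_const (hosc ω z : ℂ))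
  simpa [hoscCoeff] using h

open LineDeriv in
theorem hasDerivAt_hoscCoeff_line {ω : ℝ} (hω : 0 < ω) (f : SchwartzMap R3 ℂ) (v x : R2) (t : ℝ) :
    HasDerivAt (fun s : ℝ => hoscCoeff ω f (x + s • v))
      (hoscCoeff ω (∂_{((v, 0) : R3)} f) (x + t • v)) t := by
  obtain ⟨C, hC⟩ := exists_norm_le f
  obtain ⟨D, hD⟩ := exists_norm_le (∂_{((v, 0) : R3)} f)
  refine (hasDerivAt_integral_of_dominated_loc_of_deriv_le (μ := volume) (𝕜 := ℝ)
    (F := fun (s : ℝ) (z : ℝ) => f (x + s • v, z) * (hosc ω z : ℂ))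
    (F' := fun (s : ℝ) (z : ℝ) => (∂_{((v, 0) : R3)} f) (x + s • v, z) * (hosc ω z : ℂ))
    (bound := fun z => D * hosc ω z) (s := Set.univ) Filter.univ_mem
    (.of_forall fun s => aestronglyMeasurable_mul_hosc ω f _)
    (((integrable_hosc hω).const_mul C).mono' (aestronglyMeasurable_mul_hosc ω f _)
      (.of_forall fun z => norm_mul_hosc_le hω hC _ z))
    (aestronglyMeasurable_mul_hosc ω _ _)
    (.of_forall fun z s _ => norm_mul_hosc_le hω hD _ z)
    ((integrable_hosc hω).const_mul D)
    (.of_forall fun z s _ => ?_)).2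
  refine HasDerivAt.mul_const ?_ _
  rw [SchwartzMap.lineDerivOp_apply_eq_fderiv]
  have hl : HasDerivAt (fun s : ℝ => ((x + s • v, z) : R3)) (v, 0) s := by
    have h1 : HasDerivAt (fun s : ℝ => x + s • v) v s := by
      simpa using ((hasDerivAt_id s).smul_const v).const_add x
    exact h1.prodMk (hasDerivAt_const s z)
  exact (f.differentiable _).hasFDerivAt.comp_hasDerivAt s hl

theorem lintegral_enorm_sq_eq_ofReal (f : SchwartzMap R3 ℂ) :
    ∫⁻ p : R3, ‖f p‖ₑ ^ 2 = ENNReal.ofReal (∫ p : R3, ‖f p‖ ^ 2) := by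
  have : (volume : Measure R3).IsAddHaarMeasure := Measure.prod.instIsAddHaarMeasure _ _
  have hi : Integrable (fun p : R3 => ‖f p‖ ^ 2) := (f.memLp 2).integrable_norm_pow two_ne_zero
  rw [ofReal_integral_eq_lintegral_ofReal hi (.of_forall fun p => by positivity)]
  refine lintegral_congr fun p => ?_
  rw [ENNReal.ofReal_pow (norm_nonneg _), ofReal_norm]

open LineDeriv in
theorem lintegral_enorm_P0_pow_six_le {ω : ℝ} (hω : 0 < ω) (f : SchwartzMap R3 ℂ) :
    ∫⁻ p, ‖P0 ω f p‖ₑ ^ 6 ≤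
      36 * ((∫⁻ p, ‖f p‖ₑ ^ 2) * (∫⁻ p, ‖(∂_{ex0} f) p‖ₑ ^ 2) * ∫⁻ p, ‖(∂_{ex1} f) p‖ₑ ^ 2) *
        ENNReal.ofReal ω := by
  have hc := continuous_hosc ω
  calc ∫⁻ p, ‖P0 ω f p‖ₑ ^ 6
      = ∫⁻ p : R3, ‖hoscCoeff ω f p.1‖ₑ ^ 6 * ‖(hosc ω p.2 : ℂ)‖ₑ ^ 6 := by
        simp only [P0, enorm_mul, mul_pow]
        rfl
    _ = (∫⁻ x, ‖hoscCoeff ω f x‖ₑ ^ 6) * ∫⁻ z, ‖(hosc ω z : ℂ)‖ₑ ^ 6 :=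
        lintegral_prod_mul ((measurable_hoscCoeff ω f).enorm.pow_const 6).aemeasurable
          (g := fun z => ‖(hosc ω z : ℂ)‖ₑ ^ 6) (by fun_prop)
    _ ≤ _ := by
        refine mul_le_mul' ?_ (lintegral_hosc_pow_six_le hω)
        refine (lintegral_enorm_pow_six_le_of_hasDerivAt (measurable_hoscCoeff ω f)
          (measurable_hoscCoeff ω (∂_{ex0} f)) (measurable_hoscCoeff ω (∂_{ex1} f))
          (hasDerivAt_hoscCoeff_line hω f _) (hasDerivAt_hoscCoeff_line hω f _)
          (tendsto_hoscCoeff_line hω f (by simp)) (tendsto_hoscCoeff_line hω f (by simp))).trans ?_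
        gcongr <;> exact lintegral_enorm_hoscCoeff_sq_le hω _

/-- there is `C > 0` such that for all `ω ≥ 1` and Schwartz `f` on ℝ³,
`‖P₀f‖_{L⁶} ≤ C ω^{1/6} (‖f‖²_{L²} + ‖∇ₓf‖²_{L²})^{1/2}`. -/
theorem P0_L6_bound :
    ∃ C : ℝ, 0 < C ∧ ∀ ω : ℝ, 1 ≤ ω → ∀ f : SchwartzMap R3 ℂ,
      (eLpNorm (P0 ω (⇑f)) 6 volume).toReal ≤
        C * ω ^ ((1 : ℝ) / 6) *
          Real.sqrt ((∫ p : R3, ‖f p‖ ^ 2) +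
            ((∫ p : R3, ‖pd ex0 (⇑f) p‖ ^ 2) + (∫ p : R3, ‖pd ex1 (⇑f) p‖ ^ 2))) := by
  refine ⟨2, two_pos, fun ω hω f => ?_⟩
  have hω0 : 0 < ω := zero_lt_one.trans_le hω
  have h := lintegral_enorm_P0_pow_six_le hω0 f
  simp only [lintegral_enorm_sq_eq_ofReal] at h
  simp only [SchwartzMap.lineDerivOp_apply_eq_fderiv] at h
  change _ ≤ 36 * (ENNReal.ofReal _ * ENNReal.ofReal (∫ p : R3, ‖pd ex0 (⇑f) p‖ ^ 2) *
    ENNReal.ofReal (∫ p : R3, ‖pd ex1 (⇑f) p‖ ^ 2)) * _ at h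
  have hA : 0 ≤ ∫ p : R3, ‖f p‖ ^ 2 := integral_nonneg fun p => by positivity
  have hB₁ : 0 ≤ ∫ p : R3, ‖pd ex0 (⇑f) p‖ ^ 2 := integral_nonneg fun p => by positivity
  have hB₂ : 0 ≤ ∫ p : R3, ‖pd ex1 (⇑f) p‖ ^ 2 := integral_nonneg fun p => by positivity
  generalize (∫ p : R3, ‖f p‖ ^ 2) = A at *
  generalize (∫ p : R3, ‖pd ex0 (⇑f) p‖ ^ 2) = B₁ at *
  generalize (∫ p : R3, ‖pd ex1 (⇑f) p‖ ^ 2) = B₂ at *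
  rw [← ENNReal.ofReal_mul hA, ← ENNReal.ofReal_mul (by positivity),
    ← ENNReal.ofReal_ofNat 36, ← ENNReal.ofReal_mul (by norm_num),
    ← ENNReal.ofReal_mul (by positivity)] at h
  have hN : eLpNorm (P0 ω f) 6 volume ^ 6 = ∫⁻ p, ‖P0 ω f p‖ₑ ^ 6 := by
    have := eLpNorm_nnreal_pow_eq_lintegral (f := P0 ω f) (μ := volume) (p := 6) (by norm_num)
    simpa using this
  rw [← hN] at h
  refine (pow_le_pow_iff_left₀ ENNReal.toReal_nonneg (by positivity) (by norm_num : 6 ≠ 0)).1 ?_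
  rw [← ENNReal.toReal_pow]
  refine (ENNReal.toReal_le_of_le_ofReal (by positivity) h).trans ?_
  have hs : √(A + (B₁ + B₂)) ^ 6 = (A + (B₁ + B₂)) ^ 3 := by
    rw [show 6 = 2 * 3 from rfl, pow_mul, Real.sq_sqrt (by positivity)]
  have hw : (ω ^ ((1 : ℝ) / 6)) ^ 6 = ω := by
    rw [← Real.rpow_natCast, ← Real.rpow_mul hω0.le]; norm_num
  rw [mul_pow, mul_pow, hs, hw]
  have hS : A * B₁ * B₂ ≤ (A + (B₁ + B₂)) ^ 3 := by
    calc A * B₁ * B₂ ≤ (A + (B₁ + B₂)) * (A + (B₁ + B₂)) * (A + (B₁ + B₂)) := by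
          gcongr <;> linarith
      _ = _ := by ring
  calc 36 * (A * B₁ * B₂) * ω ≤ 64 * (A + (B₁ + B₂)) ^ 3 * ω := by
        gcongr; norm_num
    _ = _ := by ring
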